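/- Let α, ρ ∈ (0,1) with α irrational, and let u = u_{α,ρ} be the Sturmian word with slope α and intercept ρ. Then the set APR_u of abelian return words to prefixes of u satisfies APR_u = R^α_ρ ∪ R'^α_ρ, where R^α_ρ = ⋃_{ρ ≤ β < 1} { R : R is a [0,β)-itinerary } and R'^α_ρ = ⋃_{0 < γ ≤ ρ} { R : R is a [γ,1)-itinerary }. -/

import Mathlib

open Set

noncomputable section

/-- Exchange of two intervals with parameter `α`, acting on `[0,1)`:
`T_α(x) = x + 1 - α` for `x ∈ [0,α)` and `T_α(x) = x - α` for `x ∈ [α,1)`. -/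
def twoIE (α x : ℝ) : ℝ := if x < α then x + 1 - α else x - α

/-- The Sturmian word with slope `α` and intercept `ρ`:
`false` codes the letter 0 (i.e. `T_α^n(ρ) ∈ [0,α)`), `true` codes the letter 1. -/
def sturmian (α ρ : ℝ) (n : ℕ) : Bool := if α ≤ (twoIE α)^[n] ρ then true else false

/-- The factor of length `n` of an infinite word `u` starting at position `i`. -/
def seg (u : ℕ → Bool) (i n : ℕ) : List Bool := (List.range n).map (fun j => u (i + j))

/-- The prefix of length `n` of `u`. -/
def wordPrefix (u : ℕ → Bool) (n : ℕ) : List Bool := seg u 0 n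

/-- Return time of `x` to the set `I` under `twoIE α`:
the least `m ≥ 1` such that `T_α^m(x) ∈ I`. -/
def returnTime (α : ℝ) (I : Set ℝ) (x : ℝ) : ℕ :=
  sInf {m : ℕ | 0 < m ∧ (twoIE α)^[m] x ∈ I}

/-- The `I`-itinerary of `x`: the prefix of length `returnTime α I x` of the
Sturmian word with slope `α` and intercept `x`. -/
def itin (α : ℝ) (I : Set ℝ) (x : ℝ) : List Bool :=
  wordPrefix (sturmian α x) (returnTime α I x)

/-- Two binary words are abelian equivalent if they have the same length and the
same number of occurrences of the letter 0 (coded by `false`). -/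
def AbEquiv (w w' : List Bool) : Prop :=
  w.length = w'.length ∧ w.count false = w'.count false

/-- `w` is a factor of the infinite word `u`. -/
def IsFactor (u : ℕ → Bool) (w : List Bool) : Prop := ∃ i, seg u i w.length = w

/-- Positions of occurrences in `u` of factors abelian equivalent to `w`. -/
def abOcc (u : ℕ → Bool) (w : List Bool) : Set ℕ :=
  {i | AbEquiv (seg u i w.length) w}

/-- The set of abelian return words to `w` in `u`: the words of `u` lying between
two consecutive occurrences of factors abelian equivalent to `w`. -/
def AR (u : ℕ → Bool) (w : List Bool) : Set (List Bool) :=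
  {v | ∃ i j : ℕ, i ∈ abOcc u w ∧ j ∈ abOcc u w ∧ i < j ∧
        (∀ m, i < m → m < j → m ∉ abOcc u w) ∧ v = seg u i (j - i)}

/-- The set of abelian return words to all nonempty prefixes of `u`. -/
def APR (u : ℕ → Bool) : Set (List Bool) :=
  ⋃ n ∈ {n : ℕ | 1 ≤ n}, AR u (wordPrefix u n)

/-- `S_β`: the set of `[0,β)`-itineraries under `twoIE α`. -/
def Sitin (α β : ℝ) : Set (List Bool) :=
  {w | ∃ x ∈ Ico (0:ℝ) β, itin α (Ico (0:ℝ) β) x = w}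

/-- `R^α_ρ`: the union of the sets of `[0,β)`-itineraries over `ρ ≤ β < 1`. -/
def Rlight (α ρ : ℝ) : Set (List Bool) := ⋃ β ∈ Ico ρ 1, Sitin α β

/-- `R'^α_ρ`: the union of the sets of `[γ,1)`-itineraries over `0 < γ ≤ ρ`. -/
def Rheavy (α ρ : ℝ) : Set (List Bool) :=
  ⋃ γ ∈ Ioc (0:ℝ) ρ, {w | ∃ x ∈ Ico γ 1, itin α (Ico γ 1) x = w}

/-- The Gauss map `x ↦ {1/x}`. -/
def gaussMap (x : ℝ) : ℝ := Int.fract x⁻¹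

/-- The `k`-th partial quotient `a_k` (for `k ≥ 1`) of the continued fraction
expansion `α = [0; a_1, a_2, …]` of `α ∈ (0,1)`. -/
def cfa (α : ℝ) (k : ℕ) : ℕ := ⌊(gaussMap^[k - 1] α)⁻¹⌋₊

/-- `cfPQ α n = (p_{n-1}, q_{n-1})`, numerators and denominators of the convergents
of `α`: `p_{-1} = 1`, `q_{-1} = 0`, `p_0 = 0`, `q_0 = 1`,
`p_k = a_k p_{k-1} + p_{k-2}`, `q_k = a_k q_{k-1} + q_{k-2}`. -/
def cfPQ (α : ℝ) : ℕ → ℤ × ℤ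
  | 0 => (1, 0)
  | 1 => (0, 1)
  | (k + 2) => ((cfa α (k + 1) : ℤ) * (cfPQ α (k + 1)).1 + (cfPQ α k).1,
                (cfa α (k + 1) : ℤ) * (cfPQ α (k + 1)).2 + (cfPQ α k).2)

/-- `δ_{k,s} = |(s-1)(p_k - α q_k) + p_{k-1} - α q_{k-1}|` for `k ≥ 0`, `1 ≤ s ≤ a_{k+1}`. -/
def cfDelta (α : ℝ) (k s : ℕ) : ℝ :=
  |((s : ℝ) - 1) * (((cfPQ α (k + 1)).1 : ℝ) - α * ((cfPQ α (k + 1)).2 : ℝ)) +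
      (((cfPQ α k).1 : ℝ) - α * ((cfPQ α k).2 : ℝ))|

end
open scoped Topology

theorem exists_fract_add_mul_mem_Ioo {α : ℝ} (hirr : Irrational α) (c : ℝ) {a b : ℝ}
    (ha : 0 ≤ a) (hab : a < b) (hb : b ≤ 1) :
    ∃ n : ℕ, 1 ≤ n ∧ Int.fract (c + n * α) ∈ Ioo a b := by
  have : Fact ((0 : ℝ) < 1) := ⟨one_pos⟩
  have hd : DenseRange (fun k : ℤ => k • (α : AddCircle (1 : ℝ))) :=
    AddCircle.denseRange_zsmul_coe_iff.2 (by simpa using hirr)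
  have hd' := denseRange_zsmul_iff_nsmul.1 hd
  have ho : IsOpen ((fun t : ℝ => (t : AddCircle (1 : ℝ))) '' Ioo (a - c - α) (b - c - α)) :=
    QuotientAddGroup.isOpenMap_coe _ isOpen_Ioo
  obtain ⟨n, t, ht, hn⟩ := hd'.exists_mem_open ho
    ((nonempty_Ioo.2 (by linarith)).image _)
  have hn' : ((n * α - t : ℝ) : AddCircle (1 : ℝ)) = 0 := by
    have h : ((n * α : ℝ) : AddCircle (1 : ℝ)) = t := by
      rw [← nsmul_eq_mul, AddCircle.coe_nsmul]
      exact hn.symm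
    rw [AddCircle.coe_sub, h, sub_self]
  obtain ⟨k, hk⟩ := (AddCircle.coe_eq_zero_iff (1 : ℝ)).1 hn'
  have hk' : (k : ℝ) = n * α - t := by simpa using hk
  refine ⟨n + 1, by omega, ?_⟩
  have hf : Int.fract (c + ((n + 1 : ℕ) : ℝ) * α) = t + c + α := by
    rw [Int.fract_eq_iff]
    refine ⟨by linarith [ht.1], by linarith [ht.2], k, ?_⟩
    push_cast
    linarith
  rw [hf]
  exact ⟨by linarith [ht.1], by linarith [ht.2]⟩

theorem twoIE_iterate_mem_Ico {α x : ℝ} (hα : α ∈ Ioo (0 : ℝ) 1) (hx : x ∈ Ico (0 : ℝ) 1)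
    (n : ℕ) : (twoIE α)^[n] x ∈ Ico (0 : ℝ) 1 := by
  induction n with
  | zero => exact hx
  | succ n ih =>
    rw [Function.iterate_succ_apply']
    obtain ⟨h0, h1⟩ := ih
    obtain ⟨hα0, hα1⟩ := hα
    unfold twoIE at h0 h1 ⊢
    split_ifs <;> constructor <;> linarith

theorem seg_succ (u : ℕ → Bool) (i n : ℕ) : seg u i (n + 1) = seg u i n ++ [u (i + n)] := by
  simp [seg, List.range_succ]

theorem length_seg (u : ℕ → Bool) (i n : ℕ) : (seg u i n).length = n := by
  simp [seg]

theorem seg_sturmian (α x : ℝ) (i n : ℕ) :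
    seg (sturmian α x) i n = wordPrefix (sturmian α ((twoIE α)^[i] x)) n := by
  simp only [seg, wordPrefix, sturmian, ← Function.iterate_add_apply, Nat.zero_add, Nat.add_comm i]

/-- The number of zeros in a prefix measures the displacement from a translation. -/
theorem count_false_wordPrefix_sturmian (α x : ℝ) (n : ℕ) :
    ((wordPrefix (sturmian α x) n).count false : ℝ) = (twoIE α)^[n] x - x + n * α := by
  induction n with
  | zero => simp [wordPrefix, seg]
  | succ n ih =>
    unfold wordPrefix at ih ⊢
    rw [seg_succ, List.count_append, Function.iterate_succ_apply']
    push_cast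
    rw [ih]
    by_cases h : (twoIE α)^[n] x < α
    · have hs : sturmian α x (0 + n) = false := by simp [sturmian, h]
      rw [hs]
      simp only [twoIE] at h ⊢
      rw [if_pos h]
      simp
      ring
    · have hs : sturmian α x (0 + n) = true := by simpa [sturmian] using h
      rw [hs]
      simp only [twoIE] at h ⊢
      rw [if_neg h]
      simp
      ring

theorem twoIE_iterate_eq_fract {α x : ℝ} (hα : α ∈ Ioo (0 : ℝ) 1) (hx : x ∈ Ico (0 : ℝ) 1)
    (n : ℕ) : (twoIE α)^[n] x = Int.fract (x - n * α) := by
  have h := twoIE_iterate_mem_Ico hα hx n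
  refine (Int.fract_eq_iff.2 ⟨h.1, h.2, -((wordPrefix (sturmian α x) n).count false : ℤ), ?_⟩).symm
  push_cast
  rw [count_false_wordPrefix_sturmian]
  ring

theorem twoIE_iterate_eq_ite {α x : ℝ} (hα : α ∈ Ioo (0 : ℝ) 1) (hx : x ∈ Ico (0 : ℝ) 1)
    (n : ℕ) : (twoIE α)^[n] x =
      if x < Int.fract (n * α) then x - Int.fract (n * α) + 1 else x - Int.fract (n * α) := by
  rw [twoIE_iterate_eq_fract hα hx, Int.fract_eq_iff]
  have h0 := Int.fract_nonneg ((n : ℝ) * α)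
  have h1 := Int.fract_lt_one ((n : ℝ) * α)
  have h2 := Int.self_sub_floor ((n : ℝ) * α)
  obtain ⟨hx0, hx1⟩ := hx
  split_ifs with h
  · refine ⟨by linarith, by linarith, -⌊(n : ℝ) * α⌋ - 1, ?_⟩
    push_cast
    linarith
  · refine ⟨by linarith, by linarith, -⌊(n : ℝ) * α⌋, ?_⟩
    push_cast
    linarith

theorem exists_twoIE_iterate_mem_Ioo {α x : ℝ} (hα : α ∈ Ioo (0 : ℝ) 1) (hirr : Irrational α)
    (hx : x ∈ Ico (0 : ℝ) 1) {a b : ℝ} (ha : 0 ≤ a) (hab : a < b) (hb : b ≤ 1) :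
    ∃ n : ℕ, 0 < n ∧ (twoIE α)^[n] x ∈ Ioo a b := by
  obtain ⟨n, hn, h⟩ := exists_fract_add_mul_mem_Ioo hirr.neg x ha hab hb
  refine ⟨n, hn, ?_⟩
  rw [twoIE_iterate_eq_fract hα hx]
  rwa [mul_neg, ← sub_eq_add_neg] at h

theorem mem_abOcc_wordPrefix_sturmian {α ρ : ℝ} (hα : α ∈ Ioo (0 : ℝ) 1)
    (hρ : ρ ∈ Ico (0 : ℝ) 1) (n i : ℕ) :
    i ∈ abOcc (sturmian α ρ) (wordPrefix (sturmian α ρ) n) ↔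
      ((twoIE α)^[i] ρ < Int.fract (n * α) ↔ ρ < Int.fract (n * α)) := by
  have hlen : (wordPrefix (sturmian α ρ) n).length = n := length_seg _ _ _
  simp only [abOcc, mem_ofPred_eq, AbEquiv, hlen, length_seg, true_and]
  rw [seg_sturmian, ← Nat.cast_inj (R := ℝ), count_false_wordPrefix_sturmian,
    count_false_wordPrefix_sturmian]
  have hy := twoIE_iterate_mem_Ico hα hρ i
  generalize (twoIE α)^[i] ρ = y at hy ⊢
  rw [twoIE_iterate_eq_ite hα hy, twoIE_iterate_eq_ite hα hρ]
  split_ifs with h1 h2 h2 <;> simp only [h1, h2, iff_true, iff_false, not_true_eq_false]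
  · ring
  · intro h
    linarith
  · intro h
    linarith
  · simp

theorem returnTime_eq {α x : ℝ} {I : Set ℝ} {r : ℕ} (hr : 0 < r) (hmem : (twoIE α)^[r] x ∈ I)
    (hmin : ∀ m, 0 < m → m < r → (twoIE α)^[m] x ∉ I) : returnTime α I x = r := by
  refine le_antisymm (Nat.sInf_le ⟨hr, hmem⟩) ?_
  by_contra! hlt
  obtain ⟨h0, h1⟩ := Nat.sInf_mem
    (show {m : ℕ | 0 < m ∧ (twoIE α)^[m] x ∈ I}.Nonempty from ⟨r, hr, hmem⟩)
  exact hmin _ h0 hlt h1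

theorem returnTime_spec {α x : ℝ} {I : Set ℝ} (h : ∃ m, 0 < m ∧ (twoIE α)^[m] x ∈ I) :
    0 < returnTime α I x ∧ (twoIE α)^[returnTime α I x] x ∈ I ∧
      ∀ m, 0 < m → m < returnTime α I x → (twoIE α)^[m] x ∉ I := by
  obtain ⟨h0, h1⟩ := Nat.sInf_mem (show {m : ℕ | 0 < m ∧ (twoIE α)^[m] x ∈ I}.Nonempty from h)
  exact ⟨h0, h1, fun m hm hlt hI => Nat.notMem_of_lt_sInf hlt ⟨hm, hI⟩⟩

/-- If the abelian occurrences of `w` are the visits to `I`, then the abelian return words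
are the itineraries of the visiting points. -/
theorem mem_AR_sturmian_iff {α ρ : ℝ} {w : List Bool} {I : Set ℝ}
    (hI : ∀ i, i ∈ abOcc (sturmian α ρ) w ↔ (twoIE α)^[i] ρ ∈ I)
    (hret : ∀ i, ∃ m, 0 < m ∧ (twoIE α)^[m] ((twoIE α)^[i] ρ) ∈ I) (v : List Bool) :
    v ∈ AR (sturmian α ρ) w ↔
      ∃ i, (twoIE α)^[i] ρ ∈ I ∧ itin α I ((twoIE α)^[i] ρ) = v := by
  simp only [AR, mem_ofPred_eq, hI]
  constructor
  · rintro ⟨i, j, hi, hj, hij, hmin, rfl⟩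
    refine ⟨i, hi, ?_⟩
    have hr : returnTime α I ((twoIE α)^[i] ρ) = j - i := by
      refine returnTime_eq (by omega) ?_ fun m hm hlt => ?_
      · rwa [← Function.iterate_add_apply, Nat.sub_add_cancel hij.le]
      · rw [← Function.iterate_add_apply]
        exact hmin _ (by omega) (by omega)
    rw [itin, hr, seg_sturmian]
  · rintro ⟨i, hi, rfl⟩
    obtain ⟨h0, h1, h2⟩ := returnTime_spec (hret i)
    refine ⟨i, returnTime α I ((twoIE α)^[i] ρ) + i, hi, ?_, by omega, fun m hm hlt => ?_, ?_⟩
    · rwa [Function.iterate_add_apply]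
    · have := h2 (m - i) (by omega) (by omega)
      rwa [← Function.iterate_add_apply, Nat.sub_add_cancel hm.le] at this
    · rw [Nat.add_sub_cancel, seg_sturmian, itin]

theorem itin_congr {α x y : ℝ} {I J : Set ℝ} (h : ∃ m, 0 < m ∧ (twoIE α)^[m] x ∈ I)
    (hmem : (twoIE α)^[returnTime α I x] y ∈ J)
    (hmin : ∀ m, 0 < m → m < returnTime α I x → (twoIE α)^[m] y ∉ J)
    (hword : ∀ m, sturmian α y m = sturmian α x m ∨ returnTime α I x ≤ m) :
    itin α J y = itin α I x := by
  rw [itin, itin, returnTime_eq (returnTime_spec h).1 hmem hmin, wordPrefix, wordPrefix, seg, seg]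
  refine List.map_congr_left fun m hm => ?_
  rw [Nat.zero_add]
  exact (hword m).resolve_right (by simpa using hm)

/-- Iterates of the exchange are locally translations to the right of every point. -/
theorem eventually_twoIE_iterate_eq_add (α x : ℝ) (m : ℕ) :
    ∀ᶠ y in 𝓝[>] x, (twoIE α)^[m] y = (twoIE α)^[m] x + (y - x) ∧
      sturmian α y m = sturmian α x m := by
  have key : ∀ z : ℝ, ∀ᶠ y in 𝓝[>] x, (z + (y - x) < α ↔ z < α) := by
    intro z
    by_cases h : z < α
    · have : ∀ᶠ y in 𝓝 x, z + (y - x) < α :=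
        (by fun_prop : Continuous fun y => z + (y - x)).continuousAt.eventually_lt
          continuousAt_const (by simpa using h)
      filter_upwards [this.filter_mono nhdsWithin_le_nhds] with y hy
      simp [hy, h]
    · filter_upwards [self_mem_nhdsWithin] with y (hy : x < y)
      simp only [h, iff_false]
      linarith
  have hT : ∀ m : ℕ, ∀ᶠ y in 𝓝[>] x, (twoIE α)^[m] y = (twoIE α)^[m] x + (y - x) := by
    intro m
    induction m with
    | zero => simp
    | succ m ih =>
      filter_upwards [ih, key ((twoIE α)^[m] x)] with y hy hk
      rw [Function.iterate_succ_apply', Function.iterate_succ_apply', hy]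
      simp only [twoIE] at hk ⊢
      simp only [hk]
      split_ifs <;> ring
  filter_upwards [hT m, key ((twoIE α)^[m] x)] with y hy hk
  refine ⟨hy, ?_⟩
  simp only [sturmian, hy, ← not_lt, hk]

/-- Visits to points arbitrarily close to `x` from the right. -/
theorem exists_twoIE_iterate_of_eventually {α ρ x : ℝ} (hα : α ∈ Ioo (0 : ℝ) 1)
    (hirr : Irrational α) (hρ : ρ ∈ Ico (0 : ℝ) 1) (hx : x ∈ Ico (0 : ℝ) 1) {p : ℝ → Prop}
    (hp : ∀ᶠ y in 𝓝[>] x, p y) : ∃ i : ℕ, x < (twoIE α)^[i] ρ ∧ p ((twoIE α)^[i] ρ) := by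
  obtain ⟨b, hb, hsub⟩ := (mem_nhdsGT_iff_exists_Ioo_subset' hx.2).1 hp
  obtain ⟨i, -, hi⟩ := exists_twoIE_iterate_mem_Ioo hα hirr hρ hx.1
    (lt_min hb hx.2) (min_le_right b 1)
  exact ⟨i, hi.1, hsub ⟨hi.1, hi.2.trans_le (min_le_left _ _)⟩⟩

theorem eventually_twoIE_iterate_lt {α x c : ℝ} {m : ℕ} (h : (twoIE α)^[m] x < c) :
    ∀ᶠ y in 𝓝[>] x, (twoIE α)^[m] y < c := by
  have : ∀ᶠ y in 𝓝 x, (twoIE α)^[m] x + (y - x) < c :=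
    (by fun_prop : Continuous fun y => (twoIE α)^[m] x + (y - x)).continuousAt.eventually_lt
      continuousAt_const (by simpa using h)
  filter_upwards [this.filter_mono nhdsWithin_le_nhds,
    eventually_twoIE_iterate_eq_add α x m] with y hy h'
  rwa [h'.1]

theorem mem_AR_wordPrefix_light_iff {α ρ : ℝ} (hα : α ∈ Ioo (0 : ℝ) 1) (hirr : Irrational α)
    (hρ : ρ ∈ Ico (0 : ℝ) 1) {n : ℕ} (hn : ρ < Int.fract (n * α)) (v : List Bool) :
    v ∈ AR (sturmian α ρ) (wordPrefix (sturmian α ρ) n) ↔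
      ∃ i, (twoIE α)^[i] ρ ∈ Ico 0 (Int.fract (n * α)) ∧
        itin α (Ico 0 (Int.fract (n * α))) ((twoIE α)^[i] ρ) = v := by
  refine mem_AR_sturmian_iff (fun i => ?_) (fun i => ?_) v
  · have h := twoIE_iterate_mem_Ico hα hρ i
    rw [mem_abOcc_wordPrefix_sturmian hα hρ]
    simp [hn, h.1]
  · obtain ⟨m, hm, h⟩ := exists_twoIE_iterate_mem_Ioo hα hirr (twoIE_iterate_mem_Ico hα hρ i)
      le_rfl (hρ.1.trans_lt hn) (Int.fract_lt_one _).le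
    exact ⟨m, hm, h.1.le, h.2⟩

theorem mem_AR_wordPrefix_heavy_iff {α ρ : ℝ} (hα : α ∈ Ioo (0 : ℝ) 1) (hirr : Irrational α)
    (hρ : ρ ∈ Ico (0 : ℝ) 1) {n : ℕ} (hn : Int.fract (n * α) ≤ ρ) (v : List Bool) :
    v ∈ AR (sturmian α ρ) (wordPrefix (sturmian α ρ) n) ↔
      ∃ i, (twoIE α)^[i] ρ ∈ Ico (Int.fract (n * α)) 1 ∧
        itin α (Ico (Int.fract (n * α)) 1) ((twoIE α)^[i] ρ) = v := by
  refine mem_AR_sturmian_iff (fun i => ?_) (fun i => ?_) v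
  · have h := twoIE_iterate_mem_Ico hα hρ i
    rw [mem_abOcc_wordPrefix_sturmian hα hρ]
    simp [hn.not_gt, h.2]
  · obtain ⟨m, hm, h⟩ := exists_twoIE_iterate_mem_Ioo hα hirr (twoIE_iterate_mem_Ico hα hρ i)
      (Int.fract_nonneg _) (Int.fract_lt_one _) le_rfl
    exact ⟨m, hm, h.1.le, h.2⟩

theorem fract_mul_pos {α : ℝ} (hirr : Irrational α) {n : ℕ} (hn : 1 ≤ n) :
    0 < Int.fract (n * α) := by
  refine (Int.fract_nonneg _).lt_of_ne' fun h => ?_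
  obtain ⟨k, hk⟩ := Int.fract_eq_zero_iff.1 h
  exact (hirr.natCast_mul (m := n) (by omega)).ne_int k hk.symm

theorem APR_subset {α ρ : ℝ} (hα : α ∈ Ioo (0 : ℝ) 1) (hirr : Irrational α)
    (hρ : ρ ∈ Ico (0 : ℝ) 1) : APR (sturmian α ρ) ⊆ Rlight α ρ ∪ Rheavy α ρ := by
  intro v hv
  simp only [APR, mem_iUnion, mem_ofPred_eq] at hv
  obtain ⟨n, hn, hv⟩ := hv
  rcases lt_or_ge ρ (Int.fract (n * α)) with h | h
  · rw [mem_AR_wordPrefix_light_iff hα hirr hρ h] at hv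
    obtain ⟨i, hi, rfl⟩ := hv
    left
    simp only [Rlight, mem_iUnion]
    exact ⟨_, ⟨h.le, Int.fract_lt_one _⟩, _, hi, rfl⟩
  · rw [mem_AR_wordPrefix_heavy_iff hα hirr hρ h] at hv
    obtain ⟨i, hi, rfl⟩ := hv
    right
    simp only [Rheavy, mem_iUnion]
    exact ⟨_, ⟨fract_mul_pos hirr hn, h⟩, _, hi, rfl⟩

theorem Rlight_subset_APR {α ρ : ℝ} (hα : α ∈ Ioo (0 : ℝ) 1) (hirr : Irrational α)
    (hρ : ρ ∈ Ioo (0 : ℝ) 1) : Rlight α ρ ⊆ APR (sturmian α ρ) := by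
  intro v hv
  simp only [Rlight, mem_iUnion] at hv
  obtain ⟨β, ⟨hβρ, hβ1⟩, x, hx, rfl⟩ := hv
  have hβ0 : 0 < β := hρ.1.trans_le hβρ
  have hx1 : x ∈ Ico (0 : ℝ) 1 := ⟨hx.1, hx.2.trans hβ1⟩
  have hret : ∃ m, 0 < m ∧ (twoIE α)^[m] x ∈ Ico 0 β := by
    obtain ⟨m, hm, h⟩ := exists_twoIE_iterate_mem_Ioo hα hirr hx1 le_rfl hβ0 hβ1.le
    exact ⟨m, hm, h.1.le, h.2⟩
  obtain ⟨-, hr1, hr2⟩ := returnTime_spec hret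
  have hx0 : (twoIE α)^[0] x < β := hx.2
  obtain ⟨i, hxy, hloc, hyβ, hrβ⟩ := exists_twoIE_iterate_of_eventually hα hirr
    (Ioo_subset_Ico_self hρ) hx1
    (((Filter.eventually_all_finite (finite_Iic (returnTime α (Ico 0 β) x))).2 fun m _ =>
      eventually_twoIE_iterate_eq_add α x m).and
      ((eventually_twoIE_iterate_lt hx0).and (eventually_twoIE_iterate_lt hr1.2)))
  have hy := twoIE_iterate_mem_Ico hα (Ioo_subset_Ico_self hρ) i
  set y := (twoIE α)^[i] ρ
  replace hyβ : y < β := hyβ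
  obtain ⟨n, hn, hθ⟩ := exists_fract_add_mul_mem_Ioo hirr 0 hβ0.le
    (lt_min (by linarith : β < β + (y - x)) hβ1) (min_le_right _ _)
  rw [zero_add] at hθ
  simp only [APR, mem_iUnion, mem_ofPred_eq]
  refine ⟨n, hn, (mem_AR_wordPrefix_light_iff hα hirr (Ioo_subset_Ico_self hρ)
    (hβρ.trans_lt hθ.1) _).2 ⟨i, ⟨hy.1, hyβ.trans hθ.1⟩, ?_⟩⟩
  refine itin_congr hret ⟨(twoIE_iterate_mem_Ico hα hy _).1, hrβ.trans hθ.1⟩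
    (fun m hm hlt h => ?_) fun m => ?_
  · refine hr2 m hm hlt ⟨(twoIE_iterate_mem_Ico hα hx1 m).1, ?_⟩
    have h1 := (hloc m hlt.le).1
    have h2 := hθ.2.trans_le (min_le_left _ _)
    linarith [h.2]
  · exact (le_total m (returnTime α (Ico 0 β) x)).imp_left fun h => (hloc m h).2

theorem Rheavy_subset_APR {α ρ : ℝ} (hα : α ∈ Ioo (0 : ℝ) 1) (hirr : Irrational α)
    (hρ : ρ ∈ Ioo (0 : ℝ) 1) : Rheavy α ρ ⊆ APR (sturmian α ρ) := by
  intro v hv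
  simp only [Rheavy, mem_iUnion] at hv
  obtain ⟨γ, ⟨hγ0, hγρ⟩, x, hx, rfl⟩ := hv
  have hγ1 : γ < 1 := hγρ.trans_lt hρ.2
  have hx1 : x ∈ Ico (0 : ℝ) 1 := ⟨hγ0.le.trans hx.1, hx.2⟩
  have hret : ∃ m, 0 < m ∧ (twoIE α)^[m] x ∈ Ico γ 1 := by
    obtain ⟨m, hm, h⟩ := exists_twoIE_iterate_mem_Ioo hα hirr hx1 hγ0.le hγ1 le_rfl
    exact ⟨m, hm, h.1.le, h.2⟩
  obtain ⟨-, hr1, hr2⟩ := returnTime_spec hret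
  have hlow : ∀ m, 0 < m → m < returnTime α (Ico γ 1) x → (twoIE α)^[m] x < γ :=
    fun m hm hlt => not_le.1 fun h => hr2 m hm hlt ⟨h, (twoIE_iterate_mem_Ico hα hx1 m).2⟩
  obtain ⟨i, hxy, hloc, hyγ⟩ := exists_twoIE_iterate_of_eventually hα hirr
    (Ioo_subset_Ico_self hρ) hx1
    (((Filter.eventually_all_finite (finite_Iic (returnTime α (Ico γ 1) x))).2 fun m _ =>
      eventually_twoIE_iterate_eq_add α x m).and
      ((Filter.eventually_all_finite (finite_Ioo 0 (returnTime α (Ico γ 1) x))).2 fun m hm =>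
        eventually_twoIE_iterate_lt (hlow m hm.1 hm.2)))
  have hy := twoIE_iterate_mem_Ico hα (Ioo_subset_Ico_self hρ) i
  set y := (twoIE α)^[i] ρ
  have hev : ∀ᶠ t in 𝓝[<] γ,
      ∀ m ∈ Ioo 0 (returnTime α (Ico γ 1) x), (twoIE α)^[m] y < t :=
    (Filter.eventually_all_finite (finite_Ioo _ _)).2 fun m hm =>
      Filter.mem_of_superset (Ioo_mem_nhdsLT (hyγ m hm)) fun t ht => ht.1
  obtain ⟨a, ha, hsub⟩ := (mem_nhdsLT_iff_exists_Ioo_subset' hγ0).1 hev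
  obtain ⟨n, hn, hθ⟩ := exists_fract_add_mul_mem_Ioo hirr 0 (le_max_right a 0)
    (max_lt ha hγ0) hγ1.le
  rw [zero_add] at hθ
  have hθlow := hsub ⟨(le_max_left _ _).trans_lt hθ.1, hθ.2⟩
  simp only [APR, mem_iUnion, mem_ofPred_eq]
  refine ⟨n, hn, (mem_AR_wordPrefix_heavy_iff hα hirr (Ioo_subset_Ico_self hρ)
    (hθ.2.le.trans hγρ) _).2 ⟨i, ⟨by linarith [hx.1, hθ.2], hy.2⟩, ?_⟩⟩
  refine itin_congr hret ⟨?_, (twoIE_iterate_mem_Ico hα hy _).2⟩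
    (fun m hm hlt h => ?_) fun m => ?_
  · rw [(hloc _ self_mem_Iic).1]
    linarith [hr1.1, hθ.2]
  · exact (hθlow m ⟨hm, hlt⟩).not_ge h.1
  · exact (le_total m (returnTime α (Ico γ 1) x)).imp_left fun h => (hloc m h).2

/-- `APR_u = R^α_ρ ∪ R'^α_ρ`. -/
theorem APR_eq_Rlight_union_Rheavy (α ρ : ℝ) (hα : α ∈ Set.Ioo (0:ℝ) 1)
    (hirr : Irrational α) (hρ : ρ ∈ Set.Ioo (0:ℝ) 1) :
    APR (sturmian α ρ) = Rlight α ρ ∪ Rheavy α ρ := by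
  exact (APR_subset hα hirr (Ioo_subset_Ico_self hρ)).antisymm
    (union_subset (Rlight_subset_APR hα hirr hρ) (Rheavy_subset_APR hα hirr hρ))
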